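/- Let F_A be the free group on a finite set A and let φ be an automorphism of F_A. Then φ satisfies a Lipschitz condition with respect to every visual metric on F_A (that is, for every finite generating set A' of F_A, every p ∈ F_A, γ > 0, T ≥ 1 and every d ∈ V^{A'}(p,γ,T), φ is Lipschitz from (F_A,d) to (F_A,d)) if and only if φ is an inner automorphism or |A| ≤ 1. -/

import Mathlib

open scoped Classical

section Defs

variable {G : Type*}

/-- Word length of `g` with respect to a generating set `A`: the least `n` such that
`g` is a product of `n` elements of `A ∪ A⁻¹`. -/
noncomputable def wordLength [Group G] (A : Set G) (g : G) : ℕ :=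
  sInf {n : ℕ | ∃ w : List G, w.length = n ∧ (∀ x ∈ w, x ∈ A ∨ x⁻¹ ∈ A) ∧ w.prod = g}

/-- The word metric `d_A(g,h)` (as a real number). -/
noncomputable def wordDist [Group G] (A : Set G) (g h : G) : ℝ :=
  (wordLength A (g⁻¹ * h) : ℝ)

/-- The Gromov product `(x|y)_p` with respect to a distance function `d`. -/
noncomputable def gromov {X : Type*} (d : X → X → ℝ) (p x y : X) : ℝ :=
  (d p x + d p y - d x y) / 2

/-- `G` is `δ`-hyperbolic with respect to the generating set `A`. -/
def IsHyperbolicWith [Group G] (A : Set G) (δ : ℝ) : Prop :=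
  ∀ p g₀ g₁ g₂ : G,
    min (gromov (wordDist A) p g₀ g₁) (gromov (wordDist A) p g₁ g₂) - δ ≤
      gromov (wordDist A) p g₀ g₂

/-- `G` is hyperbolic with respect to the generating set `A`. -/
def IsHyperbolic [Group G] (A : Set G) : Prop :=
  ∃ δ : ℝ, 0 ≤ δ ∧ IsHyperbolicWith A δ

/-- `ρ_{p,γ}(g,h) = e^{-γ (g|h)_p}` (and `0` on the diagonal), with respect to a
distance function `dA`. -/
noncomputable def visualRhoOf {X : Type*} (dA : X → X → ℝ) (p : X) (γ : ℝ) (g h : X) : ℝ :=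
  if g = h then 0 else Real.exp (-γ * gromov dA p g h)

/-- `d` is a metric on `X`. -/
structure IsMetric {X : Type*} (d : X → X → ℝ) : Prop where
  refl : ∀ x, d x x = 0
  eq_of : ∀ x y, d x y = 0 → x = y
  symm : ∀ x y, d x y = d y x
  triangle : ∀ x y z, d x z ≤ d x y + d y z

/-- `d` is a visual metric in `V(p,γ,T)` with respect to the distance function `dA`. -/
def InVisualOf {X : Type*} (dA : X → X → ℝ) (p : X) (γ T : ℝ) (d : X → X → ℝ) : Prop :=
  IsMetric d ∧ ∀ g h : X, g ≠ h →
    visualRhoOf dA p γ g h / T ≤ d g h ∧ d g h ≤ T * visualRhoOf dA p γ g h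

/-- `d ∈ V^A(p,γ,T)`: `d` is a visual metric with respect to the word metric `d_A`. -/
def InVisual [Group G] (A : Set G) (p : G) (γ T : ℝ) (d : G → G → ℝ) : Prop :=
  InVisualOf (wordDist A) p γ T d

/-- `φ : (X,d) → (X,d')` satisfies a Hölder condition of exponent `r`. -/
def HolderCondWith {X : Type*} (d d' : X → X → ℝ) (φ : X → X) (r : ℝ) : Prop :=
  ∃ K : ℝ, 0 < K ∧ ∀ g h : X, d' (φ g) (φ h) ≤ K * d g h ^ r

/-- `φ : (X,d) → (X,d')` satisfies a Hölder condition (of some positive exponent). -/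
def SatisfiesHolder {X : Type*} (d d' : X → X → ℝ) (φ : X → X) : Prop :=
  ∃ r : ℝ, 0 < r ∧ HolderCondWith d d' φ r

/-- `φ : (X,d) → (X,d')` satisfies a Lipschitz condition. -/
def LipschitzCond {X : Type*} (d d' : X → X → ℝ) (φ : X → X) : Prop :=
  ∃ K : ℝ, 0 < K ∧ ∀ g h : X, d' (φ g) (φ h) ≤ K * d g h

/-- `φ : (X,d) → (X,d')` is uniformly continuous. -/
def UnifCont {X : Type*} (d d' : X → X → ℝ) (φ : X → X) : Prop :=
  ∀ ε : ℝ, 0 < ε → ∃ δ : ℝ, 0 < δ ∧ ∀ g h : X, d g h < δ → d' (φ g) (φ h) < ε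

/-- `φ : (X,d) → (X,d')` is a quasi-isometric embedding. -/
def QIEmbedding {X : Type*} (d d' : X → X → ℝ) (φ : X → X) : Prop :=
  ∃ lam K : ℝ, 1 ≤ lam ∧ 0 ≤ K ∧ ∀ g h : X,
    (1 / lam) * d g h - K ≤ d' (φ g) (φ h) ∧ d' (φ g) (φ h) ≤ lam * d g h + K

/-- `H` is a quasiconvex subset of `G` with respect to the generating set `A`:
every geodesic word-metric chain joining two points of `H` stays at bounded
distance from `H`. -/
def IsQuasiconvex [Group G] (A : Set G) (H : Set G) : Prop :=
  ∃ q : ℝ, 0 ≤ q ∧ ∀ h ∈ H, ∀ h' ∈ H, ∀ n : ℕ, ∀ g : ℕ → G,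
    g 0 = h → g n = h' → (n : ℝ) = wordDist A h h' →
    (∀ i < n, wordDist A (g i) (g (i + 1)) = 1) →
    ∀ i ≤ n, ∃ z ∈ H, wordDist A (g i) z ≤ q

end Defs

section WordLength

variable {G : Type*} [Group G] {A : Set G}

lemma exists_geodesic_word (hA : Subgroup.closure A = ⊤) (g : G) :
    ∃ w : List G, w.length = wordLength A g ∧ (∀ x ∈ w, x ∈ A ∨ x⁻¹ ∈ A) ∧ w.prod = g := by
  have hg : g ∈ (Subgroup.closure A).toSubmonoid := by simp [hA]
  rw [Subgroup.closure_toSubmonoid] at hg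
  obtain ⟨w, hw, hp⟩ := Submonoid.exists_list_of_mem_closure hg
  exact Nat.sInf_mem (s := {n : ℕ | ∃ w : List G, w.length = n ∧
    (∀ x ∈ w, x ∈ A ∨ x⁻¹ ∈ A) ∧ w.prod = g}) ⟨w.length, w, rfl, hw, hp⟩

lemma wordLength_prod_le {w : List G} (hw : ∀ x ∈ w, x ∈ A ∨ x⁻¹ ∈ A) :
    wordLength A w.prod ≤ w.length :=
  Nat.sInf_le ⟨w, rfl, hw, rfl⟩

lemma wordLength_mul_le (hA : Subgroup.closure A = ⊤) (g h : G) :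
    wordLength A (g * h) ≤ wordLength A g + wordLength A h := by
  obtain ⟨w, hw, hwA, rfl⟩ := exists_geodesic_word hA g
  obtain ⟨v, hv, hvA, rfl⟩ := exists_geodesic_word hA h
  rw [← hw, ← hv, ← List.prod_append, ← List.length_append]
  refine wordLength_prod_le fun x hx => ?_
  rcases List.mem_append.mp hx with hx | hx
  exacts [hwA x hx, hvA x hx]

lemma wordLength_inv_le (hA : Subgroup.closure A = ⊤) (g : G) :
    wordLength A g⁻¹ ≤ wordLength A g := by
  obtain ⟨w, hw, hwA, rfl⟩ := exists_geodesic_word hA g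
  rw [← hw, List.prod_inv_reverse]
  refine (wordLength_prod_le fun x hx => ?_).trans (by simp)
  have := hwA x⁻¹ (by simpa using hx)
  rw [inv_inv] at this
  exact this.symm

lemma wordLength_inv (hA : Subgroup.closure A = ⊤) (g : G) :
    wordLength A g⁻¹ = wordLength A g :=
  le_antisymm (wordLength_inv_le hA g) (by simpa using wordLength_inv_le hA g⁻¹)

lemma wordDist_one_left (g : G) : wordDist A 1 g = wordLength A g := by
  simp [wordDist]

lemma wordDist_comm (hA : Subgroup.closure A = ⊤) (g h : G) :
    wordDist A g h = wordDist A h g := by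
  rw [wordDist, wordDist, ← wordLength_inv hA, mul_inv_rev, inv_inv]

end WordLength

namespace FreeGroup

variable {α : Type*}

lemma reduced_append_of_mul (l h : List (α × Bool)) (hl : IsReduced l) (hh : IsReduced h) :
    ∃ a m b, l = a ++ m ∧ h = invRev m ++ b ∧ IsReduced (a ++ b) := by
  induction l using List.reverseRecOn generalizing h with
  | nil => exact ⟨[], [], h, rfl, rfl, hh⟩
  | append_singleton l x ih =>
    by_cases hr : IsReduced (l ++ [x] ++ h)
    · exact ⟨l ++ [x], [], h, by simp, rfl, hr⟩
    · obtain _ | ⟨y, h⟩ := h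
      · exact absurd hl (by simpa using hr)
      have hxy : ¬ (x.1 = y.1 → x.2 = y.2) := fun hxy => by
        refine hr ?_
        rw [IsReduced, List.isChain_append]
        refine ⟨hl, hh, ?_⟩
        simpa using hxy
      obtain ⟨a, m, b, rfl, rfl, hab⟩ := ih h (List.isChain_append.mp hl).1
        (List.isChain_cons.mp hh).2
      refine ⟨a, m ++ [x], b, by simp, ?_, hab⟩
      obtain ⟨x1, x2⟩ := x
      obtain ⟨y1, y2⟩ := y
      have : y1 = x1 ∧ y2 = !x2 := by
        simp only [Classical.not_imp] at hxy
        exact ⟨hxy.1.symm, by cases x2 <;> cases y2 <;> simp_all⟩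
      simp [this.1, this.2, invRev]

variable [DecidableEq α]

/-- The reduced word of a product arises by cancelling a suffix against an initial segment. -/
lemma exists_toWord_mul (g h : FreeGroup α) :
    ∃ a m b, g.toWord = a ++ m ∧ h.toWord = invRev m ++ b ∧ (g * h).toWord = a ++ b := by
  obtain ⟨a, m, b, h1, h2, h3⟩ := reduced_append_of_mul g.toWord h.toWord isReduced_toWord
    isReduced_toWord
  refine ⟨a, m, b, h1, h2, ?_⟩
  rw [← h3.reduce_eq, ← toWord_mk]
  congr 1
  rw [← mk_toWord (x := g), ← mk_toWord (x := h), h1, h2, ← mul_mk, ← mul_mk, ← mul_mk, ← inv_mk]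
  group

variable {A : Set (FreeGroup α)}

lemma wordLength_le_norm (hX : Set.range of ⊆ A) (g : FreeGroup α) :
    wordLength A g ≤ g.norm := by
  have h : (g.toWord.map fun x => cond x.2 (of x.1) (of x.1)⁻¹).prod = g := by
    rw [← lift_mk, lift_of_apply, mk_toWord]
  calc wordLength A g = wordLength A (g.toWord.map fun x => cond x.2 (of x.1) (of x.1)⁻¹).prod := by
        rw [h]
    _ ≤ _ := wordLength_prod_le fun x hx => by
        obtain ⟨⟨a, b⟩, -, rfl⟩ := List.mem_map.mp hx
        cases b
        · exact Or.inr (by simpa using hX ⟨a, rfl⟩)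
        · exact Or.inl (hX ⟨a, rfl⟩)
    _ = g.norm := by simp [norm]

/-- A path with jumps of bounded size passes close to every vertex of the tree geodesic. -/
lemma exists_prod_near_vertex {L : ℕ} (hL : ∀ s, s ∈ A ∨ s⁻¹ ∈ A → norm s ≤ L)
    (w : List (FreeGroup α)) (hw : ∀ x ∈ w, x ∈ A ∨ x⁻¹ ∈ A) (l r : List (α × Bool))
    (h : w.prod.toWord = l ++ r) :
    ∃ w₁ w₂, w = w₁ ++ w₂ ∧ norm ((mk l)⁻¹ * w₁.prod) ≤ L := by
  induction w using List.reverseRecOn generalizing r with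
  | nil =>
    obtain ⟨rfl, rfl⟩ : l = [] ∧ r = [] := by simpa using h.symm
    exact ⟨[], [], rfl, by simp [← one_eq_mk]⟩
  | append_singleton w s ih =>
    obtain ⟨a, m, b, h1, h2, h3⟩ := exists_toWord_mul w.prod s
    rw [List.prod_append, List.prod_singleton, h3, List.append_eq_append_iff] at h
    obtain ⟨c, rfl, rfl⟩ | ⟨c, rfl, rfl⟩ := h
    · refine ⟨w ++ [s], [], by simp, ?_⟩
      have : (mk (a ++ c))⁻¹ * (w ++ [s]).prod = mk r := by
        rw [List.prod_append, List.prod_singleton, ← mk_toWord (x := w.prod * s), h3,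
          ← List.append_assoc, ← mul_mk (L₂ := r)]
        group
      rw [this]
      refine norm_mk_le.trans (le_trans ?_ (hL s (hw s (by simp))))
      rw [norm, h2]
      simp only [List.length_append]
      omega
    · obtain ⟨w₁, w₂, rfl, hn⟩ := ih (fun x hx => hw x (by simp [hx])) (c ++ m) (by simp [h1])
      exact ⟨w₁, w₂ ++ [s], by simp, hn⟩

lemma wordLength_split_le (hX : Set.range of ⊆ A) (hA : Subgroup.closure A = ⊤) {L : ℕ}
    (hL : ∀ s, s ∈ A ∨ s⁻¹ ∈ A → norm s ≤ L) {g : FreeGroup α} {l r : List (α × Bool)}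
    (h : g.toWord = l ++ r) :
    wordLength A (mk l) + wordLength A (mk r) ≤ wordLength A g + 2 * L := by
  obtain ⟨w, hw, hwA, rfl⟩ := exists_geodesic_word hA g
  obtain ⟨w₁, w₂, rfl, hn⟩ := exists_prod_near_vertex hL w hwA l r h
  have hr : mk r = ((mk l)⁻¹ * w₁.prod) * w₂.prod := by
    rw [mul_assoc, ← List.prod_append, ← mk_toWord (x := (w₁ ++ w₂).prod), h, ← mul_mk]
    group
  have hl : mk l = w₁.prod * ((mk l)⁻¹ * w₁.prod)⁻¹ := by group
  have h1 := wordLength_mul_le hA w₁.prod ((mk l)⁻¹ * w₁.prod)⁻¹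
  have h2 := wordLength_mul_le hA ((mk l)⁻¹ * w₁.prod) w₂.prod
  rw [← hl, wordLength_inv hA] at h1
  rw [← hr] at h2
  have h3 := (wordLength_le_norm hX ((mk l)⁻¹ * w₁.prod)).trans hn
  have h4 : wordLength A w₁.prod ≤ w₁.length := wordLength_prod_le fun x hx => hwA x (by simp [hx])
  have h5 : wordLength A w₂.prod ≤ w₂.length := wordLength_prod_le fun x hx => hwA x (by simp [hx])
  rw [List.length_append] at hw
  omega

lemma le_gromov_of_eq_append (hX : Set.range of ⊆ A) (hA : Subgroup.closure A = ⊤) {L : ℕ}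
    (hL : ∀ s, s ∈ A ∨ s⁻¹ ∈ A → norm s ≤ L) {x y : FreeGroup α} {m l r : List (α × Bool)}
    (hx : x.toWord = m ++ l) (hy : y.toWord = m ++ r) :
    (wordLength A (mk m) : ℝ) - 2 * L ≤ gromov (wordDist A) 1 x y := by
  have h1 := wordLength_split_le hX hA hL hx
  have h2 := wordLength_split_le hX hA hL hy
  have h3 := wordLength_mul_le hA (mk l)⁻¹ (mk r)
  have h4 : (mk l)⁻¹ * mk r = x⁻¹ * y := by
    rw [← mk_toWord (x := x), ← mk_toWord (x := y), hx, hy, ← mul_mk, ← mul_mk]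
    group
  rw [h4, wordLength_inv hA] at h3
  rw [gromov, wordDist_one_left, wordDist_one_left, wordDist]
  have : 2 * wordLength A (mk m) + wordLength A (x⁻¹ * y) ≤
      wordLength A x + wordLength A y + 4 * L := by omega
  have : (2 * wordLength A (mk m) + wordLength A (x⁻¹ * y) : ℝ) ≤
      wordLength A x + wordLength A y + 4 * L := by exact_mod_cast this
  linarith

lemma exists_eq_append_gromov_le (hX : Set.range of ⊆ A) (hA : Subgroup.closure A = ⊤) {L : ℕ}
    (hL : ∀ s, s ∈ A ∨ s⁻¹ ∈ A → norm s ≤ L) (x y : FreeGroup α) :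
    ∃ m l r, x.toWord = m ++ l ∧ y.toWord = m ++ r ∧
      gromov (wordDist A) 1 x y ≤ (wordLength A (mk m) : ℝ) + L := by
  obtain ⟨a, m, b, h1, h2, h3⟩ := exists_toWord_mul x⁻¹ y
  have hx : x.toWord = invRev m ++ invRev a := by
    rw [← invRev_append, ← h1, toWord_inv, invRev_invRev]
  refine ⟨invRev m, invRev a, b, hx, h2, ?_⟩
  have h4 := wordLength_split_le hX hA hL h3
  have h5 : wordLength A x ≤ wordLength A (mk (invRev m)) + wordLength A (mk a) := by
    rw [← mk_toWord (x := x), hx, ← mul_mk, ← wordLength_inv hA (mk a), inv_mk]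
    exact wordLength_mul_le hA _ _
  have h6 : wordLength A y ≤ wordLength A (mk (invRev m)) + wordLength A (mk b) := by
    rw [← mk_toWord (x := y), h2, ← mul_mk]
    exact wordLength_mul_le hA _ _
  rw [gromov, wordDist_one_left, wordDist_one_left, wordDist]
  have : wordLength A x + wordLength A y ≤
      2 * wordLength A (mk (invRev m)) + wordLength A (x⁻¹ * y) + 2 * L := by omega
  have : (wordLength A x + wordLength A y : ℝ) ≤
      2 * wordLength A (mk (invRev m)) + wordLength A (x⁻¹ * y) + 2 * L := by exact_mod_cast this
  linarith

lemma gromov_hyperbolic_at_one (hX : Set.range of ⊆ A) (hA : Subgroup.closure A = ⊤) {L : ℕ}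
    (hL : ∀ s, s ∈ A ∨ s⁻¹ ∈ A → norm s ≤ L) (x y z : FreeGroup α) :
    min (gromov (wordDist A) 1 x y) (gromov (wordDist A) 1 y z) - 3 * L ≤
      gromov (wordDist A) 1 x z := by
  obtain ⟨m, l, r, hx, hy, h1⟩ := exists_eq_append_gromov_le hX hA hL x y
  obtain ⟨m', l', r', hy', hz, h2⟩ := exists_eq_append_gromov_le hX hA hL y z
  rw [hy, List.append_eq_append_iff] at hy'
  obtain ⟨c, rfl, rfl⟩ | ⟨c, rfl, rfl⟩ := hy'
  · have := le_gromov_of_eq_append hX hA hL hx (y := z) (r := c ++ r') (by simp [hz])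
    linarith [min_le_left (gromov (wordDist A) 1 x y) (gromov (wordDist A) 1 y z)]
  · have := le_gromov_of_eq_append hX hA hL (x := x) (l := c ++ l) (by simp [hx]) hz
    linarith [min_le_right (gromov (wordDist A) 1 x y) (gromov (wordDist A) 1 y z)]

end FreeGroup

section Visual

variable {X : Type*} {dA : X → X → ℝ}

lemma visualRhoOf_nonneg (p : X) (γ : ℝ) (g h : X) : 0 ≤ visualRhoOf dA p γ g h := by
  unfold visualRhoOf
  split_ifs <;> positivity

lemma visualRhoOf_of_ne {p : X} {γ : ℝ} {g h : X} (hgh : g ≠ h) :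
    visualRhoOf dA p γ g h = Real.exp (-γ * gromov dA p g h) := if_neg hgh

lemma visualRhoOf_le_mul_max {p : X} {γ δ : ℝ} (hγ : 0 ≤ γ) (hδ : 0 ≤ δ)
    (hyp : ∀ x y z, min (gromov dA p x y) (gromov dA p y z) - δ ≤ gromov dA p x z) (x y z : X) :
    visualRhoOf dA p γ x z ≤
      Real.exp (γ * δ) * max (visualRhoOf dA p γ x y) (visualRhoOf dA p γ y z) := by
  have h1 : 1 ≤ Real.exp (γ * δ) := Real.one_le_exp (by positivity)
  by_cases hxy : x = y
  · subst hxy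
    calc _ ≤ max (visualRhoOf dA p γ x x) (visualRhoOf dA p γ x z) := le_max_right _ _
      _ ≤ _ := le_mul_of_one_le_left
        ((visualRhoOf_nonneg p γ x z).trans (le_max_right _ _)) h1
  by_cases hyz : y = z
  · subst hyz
    calc _ ≤ max (visualRhoOf dA p γ x y) (visualRhoOf dA p γ y y) := le_max_left _ _
      _ ≤ _ := le_mul_of_one_le_left
        ((visualRhoOf_nonneg p γ x y).trans (le_max_left _ _)) h1
  by_cases hxz : x = z
  · rw [visualRhoOf, if_pos hxz]
    exact mul_nonneg (by positivity) ((visualRhoOf_nonneg p γ x y).trans (le_max_left _ _))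
  rw [visualRhoOf_of_ne hxy, visualRhoOf_of_ne hyz, visualRhoOf_of_ne hxz,
    mul_max_of_nonneg _ _ (by positivity), ← Real.exp_add, ← Real.exp_add, le_max_iff,
    Real.exp_le_exp, Real.exp_le_exp]
  have := hyp x y z
  rcases min_choice (gromov dA p x y) (gromov dA p y z) with h | h <;> rw [h] at this
  · left; nlinarith
  · right; nlinarith

/-- Hyperbolicity at a basepoint yields a visual metric with a small parameter. -/
lemma exists_inVisualOf {p : X} {δ : ℝ} (hδ : 0 ≤ δ) (hsymm : ∀ x y, dA x y = dA y x)
    (hyp : ∀ x y z, min (gromov dA p x y) (gromov dA p y z) - δ ≤ gromov dA p x z) :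
    ∃ γ : ℝ, 0 < γ ∧ ∃ d, InVisualOf dA p γ 2 d := by
  have hlog : 0 < Real.log 2 := Real.log_pos one_lt_two
  set γ : ℝ := Real.log 2 / (2 * δ + 1) with hγdef
  have hγ : 0 < γ := by positivity
  have hγδ : Real.exp (γ * δ) * Real.exp (γ * δ) ≤ 2 := by
    rw [← Real.exp_add, ← Real.le_log_iff_exp_le two_pos, hγdef]
    rw [div_mul_eq_mul_div, ← add_div, div_le_iff₀ (by positivity)]
    nlinarith
  let ρ : X → X → NNReal := fun x y => ⟨visualRhoOf dA p γ x y, visualRhoOf_nonneg p γ x y⟩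
  have hself : ∀ x, ρ x x = 0 := fun x => NNReal.eq (if_pos rfl)
  have hcomm : ∀ x y, ρ x y = ρ y x := fun x y => NNReal.eq <| by
    change visualRhoOf dA p γ x y = visualRhoOf dA p γ y x
    simp only [visualRhoOf, gromov, hsymm x y, add_comm (dA p x), eq_comm (a := x)]
  have hmax : ∀ x₁ x₂ x₃ x₄, ρ x₁ x₄ ≤ 2 * max (ρ x₁ x₂) (max (ρ x₂ x₃) (ρ x₃ x₄)) := by
    intro a b c e
    rw [← NNReal.coe_le_coe]
    push_cast
    change visualRhoOf dA p γ a e ≤ 2 * max (visualRhoOf dA p γ a b)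
      (max (visualRhoOf dA p γ b c) (visualRhoOf dA p γ c e))
    have h1 := visualRhoOf_le_mul_max hγ.le hδ hyp a b e
    have h2 := visualRhoOf_le_mul_max hγ.le hδ hyp b c e
    set E := Real.exp (γ * δ)
    have hE : 1 ≤ E := Real.one_le_exp (by positivity)
    set M := max (visualRhoOf dA p γ a b)
      (max (visualRhoOf dA p γ b c) (visualRhoOf dA p γ c e))
    have hM : 0 ≤ M := (visualRhoOf_nonneg p γ a b).trans (le_max_left _ _)
    calc _ ≤ E * max (visualRhoOf dA p γ a b) (visualRhoOf dA p γ b e) := h1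
      _ ≤ E * (E * M) := by
        gcongr
        refine max_le ((le_max_left _ _).trans (le_mul_of_one_le_left hM hE)) (h2.trans ?_)
        gcongr
        exact le_max_right _ _
      _ ≤ 2 * M := by rw [← mul_assoc]; gcongr
  let m := PseudoMetricSpace.ofPreNNDist ρ hself hcomm
  have hle : ∀ x y, m.dist x y ≤ visualRhoOf dA p γ x y :=
    PseudoMetricSpace.dist_ofPreNNDist_le ρ hself hcomm
  have hge : ∀ x y, visualRhoOf dA p γ x y ≤ 2 * m.dist x y :=
    PseudoMetricSpace.le_two_mul_dist_ofPreNNDist ρ hself hcomm hmax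
  refine ⟨γ, hγ, m.dist, ⟨m.dist_self, fun x y hxy => ?_, m.dist_comm, m.dist_triangle⟩,
    fun g h _ => ⟨?_, ?_⟩⟩
  · by_contra hne
    have := hge x y
    rw [hxy, visualRhoOf_of_ne hne] at this
    linarith [Real.exp_pos (-γ * gromov dA p x y)]
  · linarith [hge g h]
  · linarith [hle g h, visualRhoOf_nonneg (dA := dA) p γ g h]

end Visual

namespace FreeGroup

variable {α : Type*}

lemma closure_eq_top_of_range_of_subset {A : Set (FreeGroup α)} (hX : Set.range of ⊆ A) :
    Subgroup.closure A = ⊤ :=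
  top_le_iff.mp <| (closure_range_of α).symm.le.trans (Subgroup.closure_mono hX)

variable [DecidableEq α]

lemma exists_norm_bound {A : Set (FreeGroup α)} (hfin : A.Finite) :
    ∃ L : ℕ, ∀ s, s ∈ A ∨ s⁻¹ ∈ A → norm s ≤ L := by
  obtain ⟨L, hL⟩ := (hfin.image norm).bddAbove
  refine ⟨L, fun s hs => ?_⟩
  rcases hs with hs | hs
  · exact hL ⟨s, hs, rfl⟩
  · exact norm_inv_eq (x := s) ▸ hL ⟨s⁻¹, hs, rfl⟩

/-- An automorphism that is Lipschitz for all visual metrics does not contract word lengths by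
more than a bounded amount. -/
lemma exists_wordLength_le_of_lipschitz [Nonempty α] {φ : FreeGroup α ≃* FreeGroup α}
    (hφ : ∀ A' : Set (FreeGroup α), A'.Finite → Subgroup.closure A' = ⊤ →
      ∀ (p : FreeGroup α) (γ T : ℝ), 0 < γ → 1 ≤ T →
        ∀ d : FreeGroup α → FreeGroup α → ℝ, InVisual A' p γ T d → LipschitzCond d d ⇑φ)
    {A : Set (FreeGroup α)} (hX : Set.range of ⊆ A) (hfin : A.Finite) :
    ∃ C : ℝ, ∀ g, (wordLength A g : ℝ) ≤ wordLength A (φ g) + C := by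
  have hA := closure_eq_top_of_range_of_subset hX
  obtain ⟨L, hL⟩ := exists_norm_bound hfin
  obtain ⟨γ, hγ, d, hd⟩ := exists_inVisualOf (p := 1) (δ := 3 * L) (by positivity)
    (wordDist_comm hA) (gromov_hyperbolic_at_one hX hA hL)
  obtain ⟨K, hK, hKd⟩ := hφ A hfin hA 1 γ 2 hγ one_le_two d hd
  obtain ⟨a⟩ := ‹Nonempty α›
  set b : FreeGroup α := of a
  refine ⟨wordLength A b + Real.log (4 * K) / γ, fun g => ?_⟩
  have hne : g ≠ g * b := by simp [b]
  have hne' : φ g ≠ φ (g * b) := φ.injective.ne hne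
  have h1 := (hd.2 _ _ hne').1
  have h2 := (hd.2 _ _ hne).2
  have h3 := hKd g (g * b)
  rw [visualRhoOf_of_ne hne'] at h1
  rw [visualRhoOf_of_ne hne] at h2
  have e1 : gromov (wordDist A) 1 (φ g) (φ (g * b)) ≤ wordLength A (φ g) := by
    have : (wordLength A (φ g * φ b) : ℝ) ≤ wordLength A (φ g) + wordLength A (φ b) := by
      exact_mod_cast wordLength_mul_le hA _ _
    rw [gromov, wordDist_one_left, wordDist_one_left, wordDist, _root_.map_mul, inv_mul_cancel_left]
    linarith
  have e2 : wordLength A g - wordLength A b ≤ gromov (wordDist A) 1 g (g * b) := by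
    have h4 := wordLength_mul_le hA (g * b) b⁻¹
    rw [mul_inv_cancel_right, wordLength_inv hA] at h4
    have : (wordLength A g : ℝ) ≤ wordLength A (g * b) + wordLength A b := by exact_mod_cast h4
    rw [gromov, wordDist_one_left, wordDist_one_left, wordDist, inv_mul_cancel_left]
    linarith
  have h5 : Real.exp (-γ * wordLength A (φ g)) ≤
      4 * K * Real.exp (-γ * (wordLength A g - wordLength A b)) := by
    have h6 : Real.exp (-γ * wordLength A (φ g)) ≤
        Real.exp (-γ * gromov (wordDist A) 1 (φ g) (φ (g * b))) :=
      Real.exp_le_exp.mpr (by nlinarith)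
    have h7 : Real.exp (-γ * gromov (wordDist A) 1 g (g * b)) ≤
        Real.exp (-γ * (wordLength A g - wordLength A b)) := Real.exp_le_exp.mpr (by nlinarith)
    nlinarith
  rw [← Real.exp_log (show 0 < 4 * K by positivity), ← Real.exp_add, Real.exp_le_exp] at h5
  have h8 : (wordLength A g : ℝ) - wordLength A (φ g) - wordLength A b ≤ Real.log (4 * K) / γ := by
    rw [le_div_iff₀ hγ]
    linarith
  linarith

end FreeGroup

section Occurrences

variable {β : Type*}

/-- The number of positions at which the list `p` occurs in a list. -/
noncomputable def occurrences (p : List β) : List β → ℕ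
  | [] => 0
  | x :: l => (if p <+: x :: l then 1 else 0) + occurrences p l

lemma occurrences_le_length (p l : List β) : occurrences p l ≤ l.length := by
  induction l with
  | nil => simp [occurrences]
  | cons x l ih =>
    rw [occurrences, List.length_cons]
    split_ifs <;> omega

lemma occurrences_eq_zero {p l : List β} (h : ¬ p <:+: l) : occurrences p l = 0 := by
  induction l with
  | nil => rfl
  | cons x l ih =>
    rw [List.infix_cons_iff, not_or] at h
    rw [occurrences, if_neg h.1, ih h.2]

lemma occurrences_pos {p l : List β} (hp : p ≠ []) (h : p <:+: l) : 1 ≤ occurrences p l := by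
  induction l with
  | nil => exact absurd (List.infix_nil.mp h) hp
  | cons x l ih =>
    rw [occurrences]
    rcases List.infix_cons_iff.mp h with h | h
    · rw [if_pos h]
      omega
    · exact le_add_left (ih h)

lemma occurrences_add_le_append (p l l' : List β) :
    occurrences p l + occurrences p l' ≤ occurrences p (l ++ l') := by
  induction l with
  | nil => simp [occurrences]
  | cons x l ih =>
    rw [List.cons_append, occurrences, occurrences]
    have : p <+: x :: l → p <+: x :: (l ++ l') := fun h => h.trans (by simp)
    split_ifs <;> grind

lemma occurrences_append_le_length (p l l' : List β) :
    occurrences p (l ++ l') ≤ l.length + occurrences p l' := by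
  induction l with
  | nil => simp
  | cons x l ih =>
    rw [List.cons_append, occurrences, List.length_cons]
    split_ifs <;> omega

lemma occurrences_append_le (p l l' : List β) :
    occurrences p (l ++ l') ≤ occurrences p l + occurrences p l' + p.length := by
  induction l with
  | nil => simp [occurrences]
  | cons x l ih =>
    by_cases hlen : p.length ≤ (x :: l).length
    · have : p <+: x :: (l ++ l') → p <+: x :: l := fun h =>
        List.prefix_of_prefix_length_le h (l₂ := x :: l) (l₃ := x :: (l ++ l')) (by simp) hlen
      rw [List.cons_append, occurrences, occurrences]
      split_ifs <;> grind
    · have := occurrences_append_le_length p (x :: l) l'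
      omega

lemma mul_occurrences_le (p l : List β) (k : ℕ) :
    k * occurrences p l ≤ occurrences p (List.replicate k l).flatten := by
  induction k with
  | zero => simp
  | succ k ih =>
    rw [List.replicate_succ, List.flatten_cons]
    have := occurrences_add_le_append p l (List.replicate k l).flatten
    nlinarith

end Occurrences

namespace FreeGroup

variable {α : Type*} [DecidableEq α]

lemma occurrences_toWord_mul_le (p : List (α × Bool)) (g h : FreeGroup α) :
    occurrences p (g * h).toWord ≤
      occurrences p g.toWord + occurrences p h.toWord + p.length := by
  obtain ⟨a, m, b, h1, h2, h3⟩ := exists_toWord_mul g h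
  rw [h1, h2, h3]
  have := occurrences_append_le p a b
  have := occurrences_add_le_append p a m
  have := occurrences_add_le_append p (invRev m) b
  omega

lemma occurrences_toWord_le_wordLength {A : Set (FreeGroup α)} (hA : Subgroup.closure A = ⊤)
    {p : List (α × Bool)} {M : ℕ} (hM : ∀ s, s ∈ A ∨ s⁻¹ ∈ A → occurrences p s.toWord ≤ M)
    (g : FreeGroup α) : occurrences p g.toWord ≤ (M + p.length) * wordLength A g := by
  obtain ⟨w, hw, hwA, rfl⟩ := exists_geodesic_word hA g
  rw [← hw]
  clear hw
  induction w with
  | nil => simp [occurrences]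
  | cons s w ih =>
    rw [List.prod_cons, List.length_cons]
    have h1 := occurrences_toWord_mul_le p s w.prod
    have h2 := hM s (hwA s (by simp))
    have h3 := ih fun x hx => hwA x (by simp [hx])
    nlinarith

lemma toWord_mk_pow {l : List (α × Bool)} (hl : IsCyclicallyReduced l) (k : ℕ) :
    (mk l ^ k).toWord = (List.replicate k l).flatten := by
  rw [pow_mk, toWord_mk, (hl.flatten_replicate k).isReduced.reduce_eq]

/-- If `φ` is Lipschitz for all visual metrics, then subwords of the periodic word of `φ⁻¹ w`
are subwords of powers of `w`. -/
lemma not_infix_of_lipschitz {φ : FreeGroup α ≃* FreeGroup α} [Finite α]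
    (hφ : ∀ A' : Set (FreeGroup α), A'.Finite → Subgroup.closure A' = ⊤ →
      ∀ (p : FreeGroup α) (γ T : ℝ), 0 < γ → 1 ≤ T →
        ∀ d : FreeGroup α → FreeGroup α → ℝ, InVisual A' p γ T d → LipschitzCond d d ⇑φ)
    {w : FreeGroup α} {p : List (α × Bool)} (hp : p ≠ [])
    (hw : ∀ k : ℤ, ¬ p <:+: (w ^ k).toWord) {x : FreeGroup α} {l : List (α × Bool)}
    (hl : IsCyclicallyReduced l) (h : φ.symm w = x * mk l * x⁻¹) (n : ℕ) :
    ¬ p <:+: (List.replicate n l).flatten := by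
  intro hinf
  obtain ⟨c, p', rfl⟩ := List.exists_cons_of_ne_nil hp
  have : Nonempty α := ⟨c.1⟩
  set p := c :: p'
  set q := (List.replicate n l).flatten with hqdef
  have hq : IsCyclicallyReduced q := hl.flatten_replicate n
  set N := n * (1 + p.length) + 1 with hN
  set A : Set (FreeGroup α) := Set.range of ∪ {w ^ N} with hAdef
  have hX : Set.range of ⊆ A := Set.subset_union_left
  have hA := closure_eq_top_of_range_of_subset hX
  have hfin : A.Finite := (Set.finite_range _).union (Set.finite_singleton _)
  have hM : ∀ s, s ∈ A ∨ s⁻¹ ∈ A → occurrences p s.toWord ≤ 1 := by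
    rintro s ((⟨a, rfl⟩ | hs) | (⟨a, hs⟩ | hs))
    · exact (occurrences_le_length _ _).trans (by simp)
    · rw [Set.mem_singleton_iff.mp hs]
      have := hw N
      rw [zpow_natCast] at this
      simp [occurrences_eq_zero this]
    · rw [← inv_inv s, ← hs]
      exact (occurrences_le_length _ _).trans (by simp [toWord_inv])
    · rw [← inv_inv s, Set.mem_singleton_iff.mp hs]
      have := hw (-N)
      rw [zpow_neg, zpow_natCast] at this
      exact (occurrences_eq_zero this).le.trans zero_le_one
  obtain ⟨C, hC⟩ := exists_wordLength_le_of_lipschitz hφ hX hfin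
  set D := occurrences p x⁻¹.toWord + occurrences p x.toWord + 2 * p.length
  obtain ⟨m, hm⟩ := exists_nat_gt ((1 + p.length : ℝ) * C + D)
  set g := (φ.symm w) ^ (n * (N * m)) with hg
  have hφg : wordLength A (φ g) ≤ n * m := by
    have : φ g = (List.replicate (n * m) (w ^ N)).prod := by
      rw [hg, map_pow, MulEquiv.apply_symm_apply, List.prod_replicate, ← pow_mul]
      congr 1
      ring
    rw [this]
    refine (wordLength_prod_le fun y hy => ?_).trans (by simp)
    rw [List.eq_of_mem_replicate hy]
    exact Or.inl (Or.inr rfl)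
  have h1 := hC g
  have h2 := occurrences_toWord_le_wordLength hA hM g
  have h3 : N * m ≤ occurrences p g.toWord + D := by
    have e : mk q ^ (N * m) = x⁻¹ * g * x := by
      rw [hg, h, conj_pow, hqdef, ← pow_mk, pow_mul]
      group
    have h4 := mul_occurrences_le p q (N * m)
    rw [← toWord_mk_pow hq, e] at h4
    have h5 := occurrences_toWord_mul_le p (x⁻¹ * g) x
    have h6 := occurrences_toWord_mul_le p x⁻¹ g
    have h7 := Nat.mul_le_mul_left (N * m) (occurrences_pos hp hinf)
    omega
  have h1' : (wordLength A g : ℝ) ≤ n * m + C :=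
    h1.trans (by gcongr; exact_mod_cast hφg)
  have h8 : (N * m : ℝ) ≤ (1 + p.length) * wordLength A g + D := by
    exact_mod_cast h3.trans (by gcongr)
  have h9 : (N : ℝ) = n * (1 + p.length) + 1 := by rw [hN]; push_cast; ring
  have h10 : (1 + p.length : ℝ) * wordLength A g ≤ (1 + p.length) * (n * m + C) := by gcongr
  rw [h9] at h8
  nlinarith

end FreeGroup

namespace FreeGroup

variable {α : Type*}

lemma invRev_flatten_replicate (l : List (α × Bool)) (n : ℕ) :
    invRev (List.replicate n l).flatten = (List.replicate n (invRev l)).flatten := by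
  induction n with
  | zero => rfl
  | succ n ih =>
    rw [List.replicate_succ, List.flatten_cons, invRev_append, ih, List.replicate_succ',
      List.flatten_concat]

lemma mk_singleton_eq_zpow (a : α) (s : Bool) : ∃ e : ℤ, mk [(a, s)] = of a ^ e := by
  cases s
  · exact ⟨-1, by simp [of, inv_mk, invRev]⟩
  · exact ⟨1, by simp [of]⟩

variable [DecidableEq α]

lemma toWord_mk_zpow {l : List (α × Bool)} (hl : IsCyclicallyReduced l) (k : ℤ) :
    ∃ n : ℕ, (mk l ^ k).toWord = (List.replicate n l).flatten ∨
      (mk l ^ k).toWord = (List.replicate n (invRev l)).flatten := by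
  obtain ⟨n, rfl | rfl⟩ := k.eq_nat_or_neg
  · exact ⟨n, Or.inl (by rw [zpow_natCast, toWord_mk_pow hl])⟩
  · exact ⟨n, Or.inr (by
      rw [zpow_neg, zpow_natCast, toWord_inv, toWord_mk_pow hl, invRev_flatten_replicate])⟩

/-- Every element factors through a word not starting with `a` and not ending with `b`. -/
lemma exists_eq_zpow_mul_mul_zpow (a b : α) (x : FreeGroup α) :
    ∃ (i j : ℤ) (y : FreeGroup α), x = of a ^ i * y * of b ^ j ∧
      (∀ c ∈ y.toWord.head?, c.1 ≠ a) ∧ ∀ c ∈ y.toWord.getLast?, c.1 ≠ b := by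
  induction hn : x.norm using Nat.strong_induction_on generalizing x with
  | _ n ih =>
  subst hn
  by_cases h1 : ∀ c ∈ x.toWord.head?, c.1 ≠ a
  · by_cases h2 : ∀ c ∈ x.toWord.getLast?, c.1 ≠ b
    · exact ⟨0, 0, x, by simp, h1, h2⟩
    · push Not at h2
      obtain ⟨⟨b', s⟩, hc, h⟩ := h2
      obtain rfl : b' = b := h
      obtain ⟨t, ht⟩ := List.getLast?_eq_some_iff.mp hc
      obtain ⟨e, he⟩ := mk_singleton_eq_zpow b' s
      have hx : x = mk t * of b' ^ e := by rw [← he, mul_mk, ← ht, mk_toWord]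
      obtain ⟨i, j, y, hy, h3, h4⟩ := ih (mk t).norm (by
        refine norm_mk_le.trans_lt ?_
        rw [norm, ht]
        simp) (mk t) rfl
      exact ⟨i, j + e, y, by rw [hx, hy, zpow_add]; group, h3, h4⟩
  · push Not at h1
    obtain ⟨⟨a', s⟩, hc, h⟩ := h1
    obtain rfl : a' = a := h
    obtain ⟨t, ht⟩ := List.head?_eq_some_iff.mp hc
    obtain ⟨e, he⟩ := mk_singleton_eq_zpow a' s
    have hx : x = of a' ^ e * mk t := by
      rw [← he, mul_mk, List.singleton_append, ← ht, mk_toWord]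
    obtain ⟨i, j, y, hy, h3, h4⟩ := ih (mk t).norm (by
      refine norm_mk_le.trans_lt ?_
      rw [norm, ht]
      simp) (mk t) rfl
    exact ⟨e + i, j, y, by rw [hx, hy, zpow_add]; group, h3, h4⟩

/-- The exponent sum of a letter. -/
def expSum (a : α) : FreeGroup α →* Multiplicative ℤ :=
  lift fun c => if c = a then Multiplicative.ofAdd 1 else 1

lemma expSum_of_self (a : α) : expSum a (of a) = Multiplicative.ofAdd 1 := by
  simp [expSum]

lemma expSum_of_ne {a c : α} (h : c ≠ a) : expSum a (of c) = 1 := by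
  simp [expSum, h]

lemma exists_zpow_of_commute {a : α} {x : FreeGroup α} (h : x * of a = of a * x) :
    ∃ k : ℤ, x = of a ^ k := by
  obtain ⟨i, j, y, rfl, h1, h2⟩ := exists_eq_zpow_mul_mul_zpow a a x
  by_cases hy : y = 1
  · exact ⟨i + j, by rw [hy, mul_one, zpow_add]⟩
  exfalso
  have hcomm : y * of a = of a * y := by
    have e1 : of a ^ i * (y * of a) * of a ^ j = of a ^ i * (of a * y) * of a ^ j := by
      calc _ = of a ^ i * y * of a ^ j * of a := by group
        _ = of a * (of a ^ i * y * of a ^ j) := h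
        _ = _ := by group
    exact mul_left_cancel (mul_right_cancel e1)
  have e2 : mk (y.toWord ++ [(a, true)]) = mk ((a, true) :: y.toWord) := by
    have : mk ((a, true) :: y.toWord) = mk [(a, true)] * mk y.toWord := by
      rw [mul_mk, List.singleton_append]
    rw [this, ← mul_mk, mk_toWord]
    exact hcomm
  have r1 : IsReduced (y.toWord ++ [(a, true)]) := by
    rw [IsReduced, List.isChain_append]
    refine ⟨isReduced_toWord, by simp, fun c hc d hd hcd => absurd ?_ (h2 c hc)⟩
    simp only [List.head?_cons, Option.mem_def, Option.some.injEq] at hd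
    rw [hcd, ← hd]
  have r2 : IsReduced ((a, true) :: y.toWord) := by
    rw [← List.singleton_append, IsReduced, List.isChain_append]
    refine ⟨by simp, isReduced_toWord, fun c hc d hd hcd => absurd ?_ (h1 d hd)⟩
    simp only [List.getLast?_singleton, Option.mem_def, Option.some.injEq] at hc
    rw [← hcd, ← hc]
  have e3 := congrArg toWord e2
  rw [toWord_mk, toWord_mk, r1.reduce_eq, r2.reduce_eq] at e3
  obtain ⟨c, t, ht⟩ := List.exists_cons_of_ne_nil (mt toWord_eq_nil_iff.mp hy)
  rw [ht] at e3 h1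
  simp only [List.cons_append, List.cons.injEq] at e3
  exact h1 c rfl (by rw [e3.1])

/-- Subwords of the periodic word of `ψ w` are subwords of powers of `w`. -/
def PreservesPeriodicWords (ψ : FreeGroup α ≃* FreeGroup α) : Prop :=
  ∀ (w : FreeGroup α) (p : List (α × Bool)), p ≠ [] → (∀ k : ℤ, ¬ p <:+: (w ^ k).toWord) →
    ∀ (x : FreeGroup α) (l : List (α × Bool)), IsCyclicallyReduced l → ψ w = x * mk l * x⁻¹ →
      ∀ n, ¬ p <:+: (List.replicate n l).flatten

namespace PreservesPeriodicWords

variable {ψ : FreeGroup α ≃* FreeGroup α}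

lemma exists_conj_letter (hψ : PreservesPeriodicWords ψ) (a : α) :
    ∃ x s, ψ (of a) = x * mk [(a, s)] * x⁻¹ := by
  set L := (ψ (of a)).toWord with hL
  set l := reduceCyclically L
  set x := mk (reduceCyclically.conjugator L)
  have hl : IsCyclicallyReduced l := reduceCyclically.isCyclicallyReduced isReduced_toWord
  have hx : ψ (of a) = x * mk l * x⁻¹ := by
    rw [inv_mk, mul_mk, mul_mk, reduceCyclically.conj_conjugator_reduceCyclically, hL, mk_toWord]
  have hmem : ∀ c ∈ l, c.1 = a := by
    intro c hc
    by_contra hca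
    refine hψ (of a) [c] (by simp) (fun k hk => ?_) x l hl hx 1
      (by simpa [List.singleton_infix_iff] using hc)
    have hc' := List.singleton_infix_iff _ _ |>.mp hk
    obtain ⟨n, h | h⟩ := toWord_mk_zpow (l := [(a, true)]) (by simp) k
    all_goals
      rw [of, h] at hc'
      simp only [List.mem_flatten, List.mem_replicate] at hc'
      obtain ⟨_, ⟨-, rfl⟩, h⟩ := hc'
      simp [invRev] at h
      simp [h] at hca
  have hpow : ∀ l : List (α × Bool), (∀ c ∈ l, c.1 = a) → ∃ k : ℤ, mk l = of a ^ k := by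
    intro l
    induction l with
    | nil => exact fun _ => ⟨0, rfl⟩
    | cons c l ih =>
      intro h
      obtain ⟨k, hk⟩ := ih fun d hd => h d (by simp [hd])
      obtain ⟨c1, s⟩ := c
      obtain rfl : c1 = a := h (c1, s) (by simp)
      obtain ⟨e, he⟩ := mk_singleton_eq_zpow c1 s
      exact ⟨e + k, by rw [zpow_add, ← he, ← hk, mul_mk, List.singleton_append]⟩
  obtain ⟨k, hk⟩ := hpow l hmem
  rw [hk] at hx
  have h1 : k * Multiplicative.toAdd (expSum a (ψ.symm (of a))) = 1 := by
    have := congrArg (fun g => Multiplicative.toAdd (expSum a (ψ.symm g))) hx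
    simpa [expSum_of_self, mul_comm] using this.symm
  rcases Int.isUnit_iff.mp (IsUnit.of_mul_eq_one _ h1) with rfl | rfl
  · exact ⟨x, true, by rw [hx, zpow_one]; rfl⟩
  · exact ⟨x, false, by rw [hx]; simp [of, inv_mk, invRev]⟩

lemma rel_of_isInfix {a b : α} (hab : a ≠ b) {s t : α × Bool} {k : ℤ}
    (h : [s, t] <:+: ((of a * of b) ^ k).toWord) : s.1 ≠ t.1 ∧ s.2 = t.2 := by
  have key : ∀ (c d : α) (e : Bool) (n : ℕ), c ≠ d →
      [s, t] <:+: (List.replicate n [(c, e), (d, e)]).flatten → s.1 ≠ t.1 ∧ s.2 = t.2 := by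
    intro c d e n hcd hi
    have : List.IsChain (fun s t : α × Bool => s.1 ≠ t.1 ∧ s.2 = t.2)
        (List.replicate n [(c, e), (d, e)]).flatten := by
      rw [List.isChain_flatten (by simp)]
      refine ⟨by simp [hcd], List.isChain_replicate_of_rel _ ?_⟩
      simp [hcd.symm]
    obtain ⟨u, v, huv⟩ := hi
    rw [← huv] at this
    simpa using this.left_of_append.right_of_append
  have hl : IsCyclicallyReduced [(a, true), (b, true)] := by
    simp [IsCyclicallyReduced, IsReduced]
  obtain ⟨n, h' | h'⟩ := toWord_mk_zpow hl k
  · refine key a b true n hab ?_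
    rw [← h']
    exact h
  · refine key b a false n hab.symm ?_
    rw [show [(b, false), (a, false)] = invRev [(a, true), (b, true)] from rfl, ← h']
    exact h

lemma exists_conj_pair_sign (hψ : PreservesPeriodicWords ψ) {a b : α} (hab : a ≠ b) :
    ∃ x s, ψ (of a) = x * mk [(a, s)] * x⁻¹ ∧ ψ (of b) = x * mk [(b, s)] * x⁻¹ := by
  obtain ⟨x, s, hx⟩ := hψ.exists_conj_letter a
  obtain ⟨z, t, hz⟩ := hψ.exists_conj_letter b
  obtain ⟨i, j, y, hy, h1, h2⟩ := exists_eq_zpow_mul_mul_zpow a b (x⁻¹ * z)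
  obtain ⟨e, he⟩ := mk_singleton_eq_zpow a s
  obtain ⟨f, hf⟩ := mk_singleton_eq_zpow b t
  set X := x * of a ^ i with hX
  have ha : ψ (of a) = X * mk [(a, s)] * X⁻¹ := by
    rw [hx, he, hX]
    group
  have hb : ψ (of b) = X * y * mk [(b, t)] * (X * y)⁻¹ := by
    have : z = X * y * of b ^ j := by
      rw [hX, mul_assoc, mul_assoc, ← mul_assoc (of a ^ i), ← hy]
      group
    rw [hz, hf, this]
    group
  set Y := y.toWord with hY
  set l : List (α × Bool) := [(a, s)] ++ (Y ++ ([(b, t)] ++ invRev Y)) with hl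
  have hab' : ψ (of a * of b) = X * mk l * X⁻¹ := by
    rw [_root_.map_mul, ha, hb, hl, ← mul_mk, ← mul_mk, ← mul_mk, ← inv_mk, hY, mk_toWord]
    group
  have hYr : IsReduced Y := isReduced_toWord
  have hYr' : IsReduced (invRev Y) := by rw [hY, ← toWord_inv]; exact isReduced_toWord
  have hlr : IsCyclicallyReduced l := by
    have hlast : ∀ c ∈ (invRev Y).head?, c.1 ≠ b := by
      intro c hc
      rw [invRev, List.head?_reverse, List.getLast?_map] at hc
      obtain ⟨d, hd, rfl⟩ := Option.map_eq_some_iff.mp hc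
      exact h2 d hd
    have hfirst : ∀ c ∈ (invRev Y).getLast?, c.1 ≠ a := by
      intro c hc
      rw [invRev, List.getLast?_reverse, List.head?_map] at hc
      obtain ⟨d, hd, rfl⟩ := Option.map_eq_some_iff.mp hc
      exact h1 d hd
    have hr1 : IsReduced ([(b, t)] ++ invRev Y) := by
      rw [IsReduced, List.isChain_append]
      refine ⟨by simp, hYr', fun c hc d hd hcd => absurd ?_ (hlast d hd)⟩
      simp only [List.getLast?_singleton, Option.mem_def, Option.some.injEq] at hc
      rw [← hcd, ← hc]
    have hr2 : IsReduced (Y ++ ([(b, t)] ++ invRev Y)) := by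
      rw [IsReduced, List.isChain_append]
      refine ⟨hYr, hr1, fun c hc d hd hcd => absurd ?_ (h2 c hc)⟩
      simp only [List.singleton_append, List.head?_cons, Option.mem_def, Option.some.injEq] at hd
      rw [hcd, ← hd]
    refine ⟨?_, ?_⟩
    · rw [IsReduced, List.isChain_append]
      refine ⟨by simp, hr2, fun c hc d hd hcd => ?_⟩
      simp only [List.getLast?_singleton, Option.mem_def, Option.some.injEq] at hc
      subst hc
      rcases hYc : Y with _ | ⟨e, Y'⟩
      · simp only [hYc, List.nil_append, List.singleton_append, List.head?_cons, Option.mem_def,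
          Option.some.injEq] at hd
        exact absurd (hcd.trans (congrArg Prod.fst hd.symm)) hab
      · rw [hYc] at hd h1
        exact absurd hcd.symm (h1 d hd)
    · intro c hc d hd hcd
      simp only [hl, List.singleton_append, List.head?_cons, Option.mem_def,
        Option.some.injEq] at hd
      subst hd
      rcases hYc : invRev Y with _ | ⟨e, Y'⟩
      · have : c = (b, t) := by
          simpa [hl, hYc, List.getLast?_cons, List.getLast?_append] using hc.symm
        exact absurd (hcd.symm.trans (congrArg Prod.fst this)) hab
      · refine absurd hcd (hfirst c ?_)
        rw [hl, ← List.append_assoc, ← List.append_assoc] at hc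
        rw [hYc, List.getLast?_append_cons] at hc
        rwa [hYc]
  have hrel : ∀ c d, [c, d] <:+: l ++ l → c.1 ≠ d.1 ∧ c.2 = d.2 := by
    intro c d hcd
    by_contra hne
    exact hψ (of a * of b) [c, d] (by simp) (fun k hk => hne (rel_of_isInfix hab hk)) X l hlr hab' 2
      (by simpa using hcd)
  rcases hYc : Y with _ | ⟨c, Y'⟩
  · have hst := (hrel (a, s) (b, t) (by
      rw [hl, hYc]
      exact List.infix_append [] [(a, s), (b, t)] [(a, s), (b, t)])).2
    have hy1 : y = 1 := toWord_eq_nil_iff.mp hYc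
    obtain rfl : s = t := hst
    exact ⟨X, s, ha, by simpa [hy1] using hb⟩
  · have h3 := (hrel (a, s) c ⟨[], Y' ++ ([(b, t)] ++ invRev Y) ++ l, by simp [hl, hYc]⟩).2
    have h4 := (hrel (c.1, !c.2) (a, s) ⟨[(a, s)] ++ Y ++ [(b, t)] ++ invRev Y',
      Y ++ ([(b, t)] ++ invRev Y), by
        rw [hl, hYc]
        simp [invRev]⟩).2
    simp_all

lemma sign_eq_true (hψ : PreservesPeriodicWords ψ) {a b : α} (hab : a ≠ b) {x : FreeGroup α}
    {s : Bool} (ha : ψ (of a) = x * mk [(a, s)] * x⁻¹) (hb : ψ (of b) = x * mk [(b, s)] * x⁻¹) :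
    s = true := by
  by_contra hs
  rw [Bool.not_eq_true] at hs
  subst hs
  set l₀ : List (α × Bool) :=
    [(a, true), (a, true), (b, true), (b, true), (a, true), (b, true)] with hl₀
  set l : List (α × Bool) :=
    [(a, false), (a, false), (b, false), (b, false), (a, false), (b, false)] with hl
  set p : List (α × Bool) := [(a, false), (a, false), (b, false), (b, false)]
  have hw : ψ (mk l₀) = x * mk l * x⁻¹ := by
    have e1 : mk l₀ = of a * of a * of b * of b * of a * of b := rfl
    have e2 : mk l = mk [(a, false)] * mk [(a, false)] * mk [(b, false)] * mk [(b, false)] *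
      mk [(a, false)] * mk [(b, false)] := rfl
    rw [e1, e2]
    simp only [_root_.map_mul, ha, hb]
    group
  have hl₀r : IsCyclicallyReduced l₀ := by
    simp [hl₀, IsCyclicallyReduced, IsReduced]
  have hlr : IsCyclicallyReduced l := by
    simp [hl, IsCyclicallyReduced, IsReduced]
  refine hψ (mk l₀) p (by simp [p]) (fun k hk => ?_) x l hlr hw 1 ?_
  · obtain ⟨n, h | h⟩ := toWord_mk_zpow hl₀r k
    · rw [h] at hk
      have := hk.subset (List.mem_cons_self (a := (a, false)))
      simp [hl₀] at this
    · rw [h, hl₀] at hk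
      clear h
      have hinv : invRev l₀ =
          [(b, false), (a, false), (b, false), (b, false), (a, false), (a, false)] := rfl
      rw [hinv] at hk
      induction n with
      | zero => simp [p] at hk
      | succ n ih =>
        rw [List.replicate_succ, List.flatten_cons] at hk
        rcases n with _ | n
        · simp [p, List.infix_cons_iff, List.cons_prefix_cons, hab, hab.symm] at hk
        · simp only [List.replicate_succ, List.flatten_cons] at hk ih
          simp [p, List.infix_cons_iff, List.cons_prefix_cons, hab, hab.symm] at hk ih
          tauto
  · rw [List.replicate_one, List.flatten_singleton]
    exact (⟨[], [(a, false), (b, false)], rfl⟩ : p <:+: l)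

lemma exists_conj_pair (hψ : PreservesPeriodicWords ψ) {a b : α} (hab : a ≠ b) :
    ∃ x, ψ (of a) = x * of a * x⁻¹ ∧ ψ (of b) = x * of b * x⁻¹ := by
  obtain ⟨x, s, ha, hb⟩ := hψ.exists_conj_pair_sign hab
  obtain rfl := hψ.sign_eq_true hab ha hb
  exact ⟨x, ha, hb⟩

lemma exists_zpow_of_conj_eq {a : α} {x y : FreeGroup α}
    (h : x * of a * x⁻¹ = y * of a * y⁻¹) : ∃ k : ℤ, x⁻¹ * y = of a ^ k := by
  refine exists_zpow_of_commute ?_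
  calc x⁻¹ * y * of a = x⁻¹ * (y * of a * y⁻¹) * y := by group
    _ = x⁻¹ * (x * of a * x⁻¹) * y := by rw [h]
    _ = of a * (x⁻¹ * y) := by group

lemma exists_forall_eq_conj (hψ : PreservesPeriodicWords ψ) {a b : α} (hab : a ≠ b) :
    ∃ x, ∀ g, ψ g = x * g * x⁻¹ := by
  obtain ⟨x, ha, hb⟩ := hψ.exists_conj_pair hab
  refine ⟨x, fun g => ?_⟩
  have : ψ.toMonoidHom = (MulAut.conj x).toMonoidHom := by
    refine ext_hom _ _ fun c => ?_
    change ψ (of c) = x * of c * x⁻¹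
    by_cases hca : c = a
    · rw [hca, ha]
    by_cases hcb : c = b
    · rw [hcb, hb]
    obtain ⟨y, hya, hyc⟩ := hψ.exists_conj_pair (Ne.symm hca)
    obtain ⟨z, hzb, hzc⟩ := hψ.exists_conj_pair (Ne.symm hcb)
    obtain ⟨i, hi⟩ := exists_zpow_of_conj_eq (ha.symm.trans hya)
    obtain ⟨j, hj⟩ := exists_zpow_of_conj_eq (hb.symm.trans hzb)
    obtain ⟨k, hk⟩ := exists_zpow_of_conj_eq (hyc.symm.trans hzc)
    have h1 : of b ^ j = of a ^ i * of c ^ k := by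
      rw [← hi, ← hj, ← hk]
      group
    have h2 : i = 0 := by
      have := congrArg (fun g => Multiplicative.toAdd (expSum a g)) h1
      simpa [expSum_of_self, expSum_of_ne hca, expSum_of_ne hab.symm] using this.symm
    rw [h2, zpow_zero, inv_mul_eq_one] at hi
    rw [hi, hyc]
  exact DFunLike.congr_fun this g

end PreservesPeriodicWords

end FreeGroup

section Backward

variable {G : Type*} [Group G] {A : Set G}

lemma lipschitzCond_of_abs_wordLength_sub_le (hA : Subgroup.closure A = ⊤) {φ : G ≃* G} {C : ℝ}
    (hC : ∀ g, |(wordLength A (φ g) : ℝ) - wordLength A g| ≤ C) {p : G} {γ T : ℝ} (hγ : 0 < γ)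
    (hT : 1 ≤ T) {d : G → G → ℝ} (hd : InVisual A p γ T d) : LipschitzCond d d φ := by
  have hT0 : 0 < T := zero_lt_one.trans_le hT
  have hp : ∀ g, |wordDist A p g - wordLength A g| ≤ wordLength A p := by
    intro g
    have h1 := wordLength_mul_le hA p⁻¹ g
    have h2 := wordLength_mul_le hA p (p⁻¹ * g)
    rw [mul_inv_cancel_left] at h2
    rw [wordLength_inv hA] at h1
    rw [abs_le, wordDist]
    constructor <;> push_cast [← @Nat.cast_le ℝ] at h1 h2 <;> linarith
  set K : ℝ := (4 * wordLength A p + 3 * C) / 2 with hK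
  have hgr : ∀ g h, gromov (wordDist A) p g h - K ≤ gromov (wordDist A) p (φ g) (φ h) := by
    intro g h
    have e : wordDist A (φ g) (φ h) = wordLength A (φ (g⁻¹ * h)) := by
      rw [wordDist, map_mul, map_inv]
    have h1 := abs_le.mp (hp g)
    have h2 := abs_le.mp (hp h)
    have h3 := abs_le.mp (hp (φ g))
    have h4 := abs_le.mp (hp (φ h))
    have h5 := abs_le.mp (hC g)
    have h6 := abs_le.mp (hC h)
    have h7 := abs_le.mp (hC (g⁻¹ * h))
    have e' : wordDist A g h = wordLength A (g⁻¹ * h) := rfl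
    rw [gromov, gromov, e, e', hK]
    linarith
  refine ⟨T * T * Real.exp (γ * K), by positivity, fun g h => ?_⟩
  by_cases hgh : g = h
  · rw [hgh, hd.1.refl, hd.1.refl, mul_zero]
  have hφ : φ g ≠ φ h := φ.injective.ne hgh
  have h1 := (hd.2 _ _ hφ).2
  have h2 := (hd.2 _ _ hgh).1
  rw [visualRhoOf_of_ne hφ] at h1
  rw [visualRhoOf_of_ne hgh, div_le_iff₀ hT0] at h2
  calc d (φ g) (φ h) ≤ T * Real.exp (-γ * gromov (wordDist A) p (φ g) (φ h)) := h1
    _ ≤ T * (Real.exp (γ * K) * Real.exp (-γ * gromov (wordDist A) p g h)) := by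
      rw [← Real.exp_add]
      gcongr
      nlinarith [hgr g h]
    _ ≤ T * (Real.exp (γ * K) * (d g h * T)) := by gcongr
    _ = T * T * Real.exp (γ * K) * d g h := by ring

lemma abs_wordLength_conj_sub_le (hA : Subgroup.closure A = ⊤) (x g : G) :
    |(wordLength A (x⁻¹ * g * x) : ℝ) - wordLength A g| ≤ 2 * wordLength A x := by
  have h1 := wordLength_mul_le hA (x⁻¹ * g) x
  have h2 := wordLength_mul_le hA x⁻¹ g
  have h3 := wordLength_mul_le hA (x * (x⁻¹ * g * x)) x⁻¹
  have h4 := wordLength_mul_le hA x (x⁻¹ * g * x)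
  have e : x * (x⁻¹ * g * x) * x⁻¹ = g := by group
  rw [e] at h3
  rw [wordLength_inv hA] at h2 h3
  rw [abs_le]
  constructor <;> push_cast [← @Nat.cast_le ℝ] at h1 h2 h3 h4 <;> linarith

end Backward

lemma FreeGroup.eq_or_eq_inv_of_subsingleton {α : Type*} [DecidableEq α] [Subsingleton α]
    (φ : FreeGroup α ≃* FreeGroup α) (g : FreeGroup α) : φ g = g ∨ φ g = g⁻¹ := by
  rcases isEmpty_or_nonempty α with _ | ⟨⟨a⟩⟩
  · exact Or.inl (Subsingleton.elim _ _)
  have := uniqueOfSubsingleton a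
  have hz : ∀ x : FreeGroup α, ∃ k : ℤ, x = of a ^ k := fun x => by
    obtain ⟨y, hy⟩ := IsCyclic.exists_zpow_surjective (G := FreeGroup α)
    refine exists_zpow_of_commute ?_
    obtain ⟨m, rfl⟩ := hy x
    obtain ⟨n, hn⟩ := hy (of a)
    rw [← hn]
    exact ((Commute.refl y).zpow_zpow m n).eq
  obtain ⟨k, hk⟩ := hz (φ (of a))
  obtain ⟨l, hl⟩ := hz (φ.symm (of a))
  have h1 : k * l = 1 := by
    have h := congrArg φ hl
    rw [φ.apply_symm_apply, map_zpow, hk] at h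
    simpa [expSum_of_self, mul_comm] using
      (congrArg (fun x => Multiplicative.toAdd (expSum a x)) h).symm
  obtain ⟨m, rfl⟩ := hz g
  rw [map_zpow, hk]
  rcases Int.isUnit_iff.mp (IsUnit.of_mul_eq_one _ h1) with rfl | rfl
  · exact Or.inl (by rw [zpow_one])
  · exact Or.inr (by rw [zpow_neg_one, inv_zpow])

/-- An automorphism of a finitely generated free group satisfies a
Lipschitz condition with respect to *every* visual metric (over all finite generating
sets) iff it is inner or the rank is at most 1. -/
theorem stmt_16 {α : Type*} [Fintype α] [DecidableEq α]
    (φ : FreeGroup α ≃* FreeGroup α) :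
    (∀ A' : Set (FreeGroup α), A'.Finite → Subgroup.closure A' = ⊤ →
      ∀ (p : FreeGroup α) (γ T : ℝ), 0 < γ → 1 ≤ T →
        ∀ d : FreeGroup α → FreeGroup α → ℝ, InVisual A' p γ T d →
          LipschitzCond d d ⇑φ) ↔
      ((∃ x : FreeGroup α, ∀ g : FreeGroup α, φ g = x⁻¹ * g * x) ∨
        Fintype.card α ≤ 1) := by
  constructor
  · intro hφ
    refine or_iff_not_imp_right.mpr fun hcard => ?_
    obtain ⟨a, b, hab⟩ := Fintype.one_lt_card_iff.mp (not_le.mp hcard)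
    have hψ : FreeGroup.PreservesPeriodicWords φ.symm := fun w p hp hw x l hl h n =>
      FreeGroup.not_infix_of_lipschitz hφ hp hw hl h n
    obtain ⟨x, hx⟩ := hψ.exists_forall_eq_conj hab
    refine ⟨x, fun g => ?_⟩
    rw [← MulEquiv.eq_symm_apply, hx]
    group
  · rintro (⟨x, hx⟩ | hcard) A' - hA p γ T hγ hT d hd
    · exact lipschitzCond_of_abs_wordLength_sub_le hA
        (fun g => hx g ▸ abs_wordLength_conj_sub_le hA x g) hγ hT hd
    · have := Fintype.card_le_one_iff_subsingleton.mp hcard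
      refine lipschitzCond_of_abs_wordLength_sub_le hA (C := 0) (fun g => ?_) hγ hT hd
      rcases FreeGroup.eq_or_eq_inv_of_subsingleton φ g with h | h
      · simp [h]
      · simp [h, wordLength_inv hA]
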